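/- arXiv:2010.10617 — 13 statements merged into one kernel-verified Lean document; each statement's English description precedes it below -/
import Mathlib

section
/- Let K be a field of characteristic zero with a derivation d, let z ∈ K satisfy d z = 1, let α ∈ K be constant, and let ε ∈ {1, −1}. Suppose w ∈ K satisfies the second Painlevé equation d²w = 2w³ + z·w + α, and suppose the element D := 2(ε·d w − w²) − z is nonzero. Then the Bäcklund transform w̃ := w − (2α − ε)/D satisfies the second Painlevé equation with transformed parameter: d²w̃ = 2w̃³ + z·w̃ + (ε − α). -/
/-- Bäcklund transformation of the second Painlevé equation PII(α):
if `w` solves `d²w = 2w³ + z·w + α` and the denominator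
`D = 2(ε·dw − w²) − z` is nonzero, then `w̃ = w − (2α − ε)/D` solves
PII with parameter `ε − α`. -/
theorem backlund_PII_first {K : Type*} [Field K] [CharZero K]
    (d : K → K)
    (hd_add : ∀ x y : K, d (x + y) = d x + d y)
    (hd_mul : ∀ x y : K, d (x * y) = x * d y + d x * y)
    (z : K) (hz : d z = 1)
    (α : K) (hα : d α = 0)
    (ε : K) (hε : ε = 1 ∨ ε = -1)
    (w : K) (hw : d (d w) = 2 * w ^ 3 + z * w + α)
    (hD : 2 * (ε * d w - w ^ 2) - z ≠ 0) :
    let wt := w - (2 * α - ε) / (2 * (ε * d w - w ^ 2) - z)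
    d (d wt) = 2 * wt ^ 3 + z * wt + (ε - α) := by
  intro wt
  have d_zero : d 0 = 0 := by simpa using hd_add 0 0
  have d_one : d 1 = 0 := by simpa using hd_mul 1 1
  have d_neg (x : K) : d (-x) = -d x := by
    have h := hd_add x (-x)
    rw [add_neg_cancel, d_zero] at h
    linear_combination -h
  have d_sub (x y : K) : d (x - y) = d x - d y := by
    rw [sub_eq_add_neg, hd_add, d_neg, sub_eq_add_neg]
  have d_two : d 2 = 0 := by
    rw [← one_add_one_eq_two, hd_add, d_one, add_zero]
  have d_ε : d ε = 0 := by
    rcases hε with rfl | rfl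
    · exact d_one
    · rw [d_neg, d_one, neg_zero]
  have ε_sq : ε ^ 2 = 1 := by rcases hε with rfl | rfl <;> norm_num
  obtain ⟨D, D_def⟩ : ∃ D, D = 2 * (ε * d w - w ^ 2) - z := ⟨_, rfl⟩
  obtain ⟨u, u_def⟩ : ∃ u, u = (2 * α - ε) / D := ⟨_, rfl⟩
  have wt_eq : wt = w - u := by rw [u_def, D_def]
  rw [← D_def] at hD
  have u_mul : u * D = 2 * α - ε := by rw [u_def, div_mul_cancel₀ _ hD]
  have d_D : d D = ε * (2 * α - ε) - 2 * ε * w * D := by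
    rw [D_def, d_sub, hd_mul, d_sub, hd_mul ε, pow_two, hd_mul w, d_two, d_ε, hz, hw]
    linear_combination (1 + 4 * w * d w) * ε_sq
  -- The quotient `u` satisfies a Riccati equation.
  have d_u : d u = ε * (2 * w * u - u ^ 2) := by
    have h := congrArg d u_mul
    rw [hd_mul, d_sub, hd_mul, d_two, hα, d_ε, d_D] at h
    apply mul_right_cancel₀ hD
    linear_combination h + ε * u * u_mul
  have d_d_u : d (d u) = ε * (2 * (w * d u + d w * u) - 2 * u * d u) := by
    rw [d_u, hd_mul ε, d_ε, d_sub, mul_assoc, hd_mul 2, d_two, hd_mul w, pow_two, hd_mul u, d_u]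
    ring
  rw [wt_eq, d_sub, d_sub, d_d_u, d_u, hw]
  linear_combination (-2 * (w - u) * (2 * w * u - u ^ 2)) * ε_sq - u_mul + u * D_def
end

section
/- Let K be a field of characteristic zero with a derivation d, let z ∈ K satisfy d z = 1, let α, t₁ ∈ K be constant, and let ε ∈ {1, −1}. Suppose w ∈ K satisfies the second member of the non-stationary second Painlevé hierarchy d⁴w − 10w²·d²w − 10w·(d w)² + 6w⁵ + t₁·(d²w − 2w³) = z·w + α. Set u := ε·d w − w² and suppose D := 2(d²u + 3u²) + 2t₁·u − z is nonzero. Then w̃ := w − (2α − ε)/D satisfies the same fourth-order equation with parameter ε − α in place of α (and the same t₁): d⁴w̃ − 10w̃²·d²w̃ − 10w̃·(d w̃)² + 6w̃⁵ + t₁·(d²w̃ − 2w̃³) = z·w̃ + (ε − α). -/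
/-- Factorization of the equation through the Miura map `u = ε * d w - w ^ 2`: the operator
`ε * d + 2 * w` sends the Bäcklund denominator to `2 * (PII₂(w) - z * w) - ε`. -/
theorem miura_factorization_PII_second {K : Type*} [Field K] [CharZero K]
    (d : K → K)
    (hd_add : ∀ x y : K, d (x + y) = d x + d y)
    (hd_mul : ∀ x y : K, d (x * y) = x * d y + d x * y)
    (z : K) (hz : d z = 1) (t₁ : K) (ht₁ : d t₁ = 0)
    (ε : K) (hε : ε ^ 2 = 1) (hdε : d ε = 0) (w u : K) (hu : u = ε * d w - w ^ 2) :
    ε * d (2 * (d (d u) + 3 * u ^ 2) + 2 * t₁ * u - z)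
        + 2 * w * (2 * (d (d u) + 3 * u ^ 2) + 2 * t₁ * u - z)
      = 2 * (d (d (d (d w))) - 10 * w ^ 2 * d (d w) - 10 * w * (d w) ^ 2 + 6 * w ^ 5
        + t₁ * (d (d w) - 2 * w ^ 3) - z * w) - ε := by
  let δ : Derivation ℤ K K := Derivation.mk' (AddMonoidHom.mk' d hd_add).toIntLinearMap
    fun x y => by simp [hd_mul, mul_comm]
  have hd_sub : ∀ x y : K, d (x - y) = d x - d y := δ.map_sub
  have hd_sq : ∀ x : K, d (x ^ 2) = 2 * (x * d x) := fun x => by rw [sq, hd_mul]; ring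
  have hd_two : d 2 = 0 := δ.map_natCast 2
  have hd_three : d 3 = 0 := δ.map_natCast 3
  have hu₁ : d u = ε * d (d w) - 2 * (w * d w) := by
    rw [hu, hd_sub, hd_mul, hd_sq, hdε]; ring
  have hu₂ : d (d u) = ε * d (d (d w)) - 2 * (w * d (d w) + d w * d w) := by
    simp only [hu₁, hd_sub, hd_mul, hdε, hd_two]; ring
  have hu₃ : d (d (d u)) = ε * d (d (d (d w))) - 2 * (w * d (d (d w)) + 3 * (d w * d (d w))) := by
    simp only [hu₂, hd_sub, hd_add, hd_mul, hdε, hd_two]; ring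
  have hD : d (2 * (d (d u) + 3 * u ^ 2) + 2 * t₁ * u - z)
      = 2 * (d (d (d u)) + 6 * u * d u) + 2 * t₁ * d u - 1 := by
    simp only [hd_sub, hd_add, hd_mul, hd_sq, hd_two, hd_three, ht₁, hz]; ring
  rw [hD, hu₃, hu₂, hu₁, hu]
  linear_combination (2 * d (d (d (d w))) + 2 * t₁ * d (d w) + 12 * ε * d w * d (d w)
    - 12 * w * (d w) ^ 2 - 12 * w ^ 2 * d (d w)) * hε

/-- Bäcklund transformation of the second member of the non-stationary
second Painlevé hierarchy PII₂(α, t₁). -/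
theorem backlund_PII_second {K : Type*} [Field K] [CharZero K]
    (d : K → K)
    (hd_add : ∀ x y : K, d (x + y) = d x + d y)
    (hd_mul : ∀ x y : K, d (x * y) = x * d y + d x * y)
    (z : K) (hz : d z = 1)
    (α : K) (hα : d α = 0)
    (t₁ : K) (ht₁ : d t₁ = 0)
    (ε : K) (hε : ε = 1 ∨ ε = -1)
    (w : K)
    (hw : d (d (d (d w))) - 10 * w ^ 2 * d (d w) - 10 * w * (d w) ^ 2 + 6 * w ^ 5
        + t₁ * (d (d w) - 2 * w ^ 3) = z * w + α)
    (hD : 2 * (d (d (ε * d w - w ^ 2)) + 3 * (ε * d w - w ^ 2) ^ 2)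
        + 2 * t₁ * (ε * d w - w ^ 2) - z ≠ 0) :
    let wt := w - (2 * α - ε) /
      (2 * (d (d (ε * d w - w ^ 2)) + 3 * (ε * d w - w ^ 2) ^ 2)
        + 2 * t₁ * (ε * d w - w ^ 2) - z)
    d (d (d (d wt))) - 10 * wt ^ 2 * d (d wt) - 10 * wt * (d wt) ^ 2 + 6 * wt ^ 5
        + t₁ * (d (d wt) - 2 * wt ^ 3) = z * wt + (ε - α) := by
  intro wt
  let δ : Derivation ℤ K K := Derivation.mk' (AddMonoidHom.mk' d hd_add).toIntLinearMap
    fun x y => by simp [hd_mul, mul_comm]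
  have hd_sub : ∀ x y : K, d (x - y) = d x - d y := δ.map_sub
  have hd_one : d 1 = 0 := δ.map_one_eq_zero
  have hd_neg : ∀ x : K, d (-x) = -d x := δ.map_neg
  have hd_two : d 2 = 0 := δ.map_natCast 2
  have hdε : d ε = 0 := by rcases hε with rfl | rfl <;> simp [hd_neg, hd_one]
  have hε_sq : ε ^ 2 = 1 := by rcases hε with rfl | rfl <;> norm_num
  have key := miura_factorization_PII_second d hd_add hd_mul z hz t₁ ht₁ ε hε_sq hdε
  have hmw := key w _ rfl
  obtain ⟨D, hD_eq⟩ : ∃ D, D = 2 * (d (d (ε * d w - w ^ 2)) + 3 * (ε * d w - w ^ 2) ^ 2)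
      + 2 * t₁ * (ε * d w - w ^ 2) - z := ⟨_, rfl⟩
  have hwt : (w - wt) * D = 2 * α - ε := by
    simp only [wt, ← hD_eq] at hD ⊢
    field_simp
    ring
  rw [← hD_eq] at hD hmw
  have hdD : ε * d D = -(w + wt) * D := by linear_combination hmw + 2 * hw - hwt
  have hdwt : (w - wt) * d D + (d w - d wt) * D = 0 := by
    rw [← hd_sub, ← hd_mul, hwt, hd_sub, hd_mul, hα, hd_two, hdε]; ring
  -- The Bäcklund transformation preserves the Miura potential.
  have hu : ε * d w - w ^ 2 = ε * d wt - wt ^ 2 :=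
    mul_right_cancel₀ hD (by linear_combination ε * hdwt - (w - wt) * hdD)
  have hmwt := key wt _ hu
  rw [← hD_eq] at hmwt
  refine mul_left_cancel₀ (two_ne_zero (α := K)) ?_
  linear_combination hdD - hmwt - hwt
end

section
/- Let K be a field of characteristic zero with a derivation d, let z ∈ K satisfy d z = 1, let α ∈ K be constant, and let ε ∈ {1, −1}. Suppose w ∈ K satisfies d²w = 2w³ + z·w + α and D := 2(ε·d w − w²) − z ≠ 0, and set w̃ := w − (2α − ε)/D. Then the expression ε·d w − w² is invariant under this Bäcklund transformation: ε·d w̃ − w̃² = ε·d w − w². -/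
/-- The quantity `ε·dw − w²` is invariant under the Bäcklund transformation
of the second Painlevé equation. -/
theorem backlund_PII_first_invariant {K : Type*} [Field K] [CharZero K]
    (d : K → K)
    (hd_add : ∀ x y : K, d (x + y) = d x + d y)
    (hd_mul : ∀ x y : K, d (x * y) = x * d y + d x * y)
    (z : K) (hz : d z = 1)
    (α : K) (hα : d α = 0)
    (ε : K) (hε : ε = 1 ∨ ε = -1)
    (w : K) (hw : d (d w) = 2 * w ^ 3 + z * w + α)
    (hD : 2 * (ε * d w - w ^ 2) - z ≠ 0) :
    let wt := w - (2 * α - ε) / (2 * (ε * d w - w ^ 2) - z)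
    ε * d wt - wt ^ 2 = ε * d w - w ^ 2 := by
  intro wt
  set D := 2 * (ε * d w - w ^ 2) - z with hDdef
  have h_one : d 1 = 0 := by simpa using hd_mul 1 1
  have h_zero : d 0 = 0 := by simpa using hd_add 0 0
  have h_neg (x : K) : d (-x) = -d x := by
    have h := hd_add x (-x)
    rw [add_neg_cancel, h_zero] at h
    linear_combination -h
  have h_two : d 2 = 0 := by rw [← one_add_one_eq_two, hd_add, h_one, add_zero]
  have hdε : d ε = 0 := by rcases hε with rfl | rfl <;> simp [h_neg, h_one]
  have hεε : ε * ε = 1 := by rcases hε with rfl | rfl <;> ring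
  -- `D` satisfies the linear equation `dD = -2εwD + ε(2α - ε)`.
  have hdD : d D = -2 * ε * w * D + ε * (2 * α - ε) := by
    simp only [hDdef, sub_eq_add_neg, pow_two, hd_add, hd_mul, h_neg, h_two, hdε, hz, hw]
    linear_combination (1 + 4 * w * d w) * hεε
  have hdc : d (2 * α - ε) = 0 := by
    simp [sub_eq_add_neg, hd_add, hd_mul, h_neg, h_two, hdε, hα]
  obtain ⟨q, hq⟩ : ∃ q, q = (2 * α - ε) / D := ⟨_, rfl⟩
  have hqD : q * D = 2 * α - ε := by rw [hq, div_mul_cancel₀ _ hD]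
  -- Hence the quotient `q = (2α - ε) / D` satisfies a Riccati equation.
  have hdq : d q = 2 * ε * w * q - ε * q ^ 2 := by
    have h := hd_mul q D
    rw [hqD, hdc, hdD] at h
    refine mul_right_cancel₀ hD ?_
    linear_combination -h + ε * q * hqD
  have hwt : wt = w + -q := by rw [hq, ← sub_eq_add_neg]
  rw [hwt, hd_add, h_neg, hdq]
  linear_combination (q ^ 2 - 2 * w * q) * hεε
end

section
/- Let K be a field of characteristic zero with a derivation d, let z ∈ K satisfy d z = 1, let α, t₁ ∈ K be constant, and let ε ∈ {1, −1}. Suppose w ∈ K satisfies d⁴w − 10w²·d²w − 10w·(d w)² + 6w⁵ + t₁·(d²w − 2w³) = z·w + α, set u := ε·d w − w², and suppose D := 2(d²u + 3u²) + 2t₁·u − z ≠ 0. Then the Bäcklund transform w̃ := w − (2α − ε)/D satisfies ε·d w̃ − w̃² = ε·d w − w². -/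
/-- The quantity `ε·dw − w²` is invariant under the Bäcklund transformation
of the second member of the non-stationary second Painlevé hierarchy. -/
theorem backlund_PII_second_invariant {K : Type*} [Field K] [CharZero K]
    (d : K → K)
    (hd_add : ∀ x y : K, d (x + y) = d x + d y)
    (hd_mul : ∀ x y : K, d (x * y) = x * d y + d x * y)
    (z : K) (hz : d z = 1)
    (α : K) (hα : d α = 0)
    (t₁ : K) (ht₁ : d t₁ = 0)
    (ε : K) (hε : ε = 1 ∨ ε = -1)
    (w : K)
    (hw : d (d (d (d w))) - 10 * w ^ 2 * d (d w) - 10 * w * (d w) ^ 2 + 6 * w ^ 5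
        + t₁ * (d (d w) - 2 * w ^ 3) = z * w + α)
    (hD : 2 * (d (d (ε * d w - w ^ 2)) + 3 * (ε * d w - w ^ 2) ^ 2)
        + 2 * t₁ * (ε * d w - w ^ 2) - z ≠ 0) :
    let wt := w - (2 * α - ε) /
      (2 * (d (d (ε * d w - w ^ 2)) + 3 * (ε * d w - w ^ 2) ^ 2)
        + 2 * t₁ * (ε * d w - w ^ 2) - z)
    ε * d wt - wt ^ 2 = ε * d w - w ^ 2 := by
  have d_one : d 1 = 0 := by
    have h := hd_mul 1 1
    rw [mul_one, one_mul, mul_one] at h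
    exact left_eq_add.mp h
  have d_zero : d 0 = 0 := by
    have h := hd_add 0 0
    rw [add_zero] at h
    exact left_eq_add.mp h
  have d_neg (x : K) : d (-x) = -d x := by
    have h := hd_add x (-x)
    rw [add_neg_cancel, d_zero] at h
    linear_combination -h
  have d_sub (x y : K) : d (x - y) = d x - d y := by
    rw [sub_eq_add_neg, hd_add, d_neg, sub_eq_add_neg]
  have d_sq (x : K) : d (x ^ 2) = 2 * (x * d x) := by
    rw [pow_two, hd_mul]; ring
  have d_two : d 2 = 0 := by
    rw [← one_add_one_eq_two, hd_add, d_one, add_zero]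
  have d_three : d 3 = 0 := by
    rw [← two_add_one_eq_three, hd_add, d_one, d_two, add_zero]
  have d_eps : d ε = 0 := by
    rcases hε with rfl | rfl
    · exact d_one
    · rw [d_neg, d_one, neg_zero]
  intro wt
  -- `D` satisfies the linear equation `ε * d D + 2 * w * D = 2 * α - ε`.
  have linear_eq : ε * d (2 * (d (d (ε * d w - w ^ 2)) + 3 * (ε * d w - w ^ 2) ^ 2)
        + 2 * t₁ * (ε * d w - w ^ 2) - z)
      + 2 * w * (2 * (d (d (ε * d w - w ^ 2)) + 3 * (ε * d w - w ^ 2) ^ 2)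
        + 2 * t₁ * (ε * d w - w ^ 2) - z) = 2 * α - ε := by
    simp only [hd_add, d_sub, d_sq, hd_mul, d_two, d_three, d_eps, ht₁, hz, mul_zero,
      zero_mul, add_zero]
    rcases hε with rfl | rfl <;> linear_combination 2 * hw
  revert wt
  generalize 2 * (d (d (ε * d w - w ^ 2)) + 3 * (ε * d w - w ^ 2) ^ 2)
    + 2 * t₁ * (ε * d w - w ^ 2) - z = D at hD linear_eq ⊢
  intro wt
  have quotient_mul : (2 * α - ε) / D * D = 2 * α - ε := div_mul_cancel₀ _ hD
  have d_wt : d wt = d w - d ((2 * α - ε) / D) := d_sub _ _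
  have hwt : wt = w - (2 * α - ε) / D := rfl
  have d_quotient : (2 * α - ε) / D * d D + d ((2 * α - ε) / D) * D = 0 := by
    rw [← hd_mul, quotient_mul, d_sub, hd_mul, d_two, hα, d_eps]
    ring
  rw [d_wt, hwt]
  generalize (2 * α - ε) / D = q at quotient_mul d_quotient ⊢
  apply mul_right_cancel₀ hD
  linear_combination -ε * d_quotient + q * linear_eq - q * quotient_mul
end

section
/- Let A be a commutative ring with a derivation d : A → A. For every w ∈ A, writing u₊ := d w − w² and u₋ := −d w − w², the following identity holds: d²u₋ + 3u₋² = d²u₊ + 3u₊² − 2·d( d u₊ + 2w·u₊ ). (This is the instance k = 2 of the identity 𝓛_k[−w′ − w²] = 𝓛_k[w′ − w²] − 2·(d/dz)·((d/dz) + 2w)·𝓛_{k−1}[w′ − w²] for the Lenard operators, where 𝓛₂[u] = d²u + 3u².) -/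
/-- The Lenard-operator identity
`𝓛₂[−w′ − w²] = 𝓛₂[w′ − w²] − 2·d((d + 2w)·𝓛₁[w′ − w²])`
in a commutative ring with derivation. -/
theorem lenard_identity_k2 {A : Type*} [CommRing A]
    (d : A → A)
    (hd_add : ∀ x y : A, d (x + y) = d x + d y)
    (hd_mul : ∀ x y : A, d (x * y) = x * d y + d x * y)
    (w : A) :
    let up := d w - w ^ 2
    let um := -d w - w ^ 2
    d (d um) + 3 * um ^ 2 = d (d up) + 3 * up ^ 2 - 2 * d (d up + 2 * w * up) := by
  have d_zero : d 0 = 0 := by simpa using hd_add 0 0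
  have d_neg (x : A) : d (-x) = -d x := by
    rw [eq_neg_iff_add_eq_zero, ← hd_add, neg_add_cancel, d_zero]
  have d_sub (x y : A) : d (x - y) = d x - d y := by
    rw [sub_eq_add_neg, hd_add, d_neg, ← sub_eq_add_neg]
  intro up um
  simp only [up, um, two_mul, pow_two, add_mul, d_sub, d_neg, hd_add, hd_mul]
  ring
end

section
/- Let u : ℕ → ℂ[X] be a sequence of nonzero polynomials with u₀ = 1, u₁ = X, satisfying the Yablonskii–Vorobiev recurrence u_{m+1}·u_{m−1} = X·u_m² − 4(u_m·u_m″ − (u_m′)²) for all m ≥ 1. Then for every m ≥ 1 the rational function w_m := u_{m−1}′/u_{m−1} − u_m′/u_m ∈ ℂ(X) satisfies the second Painlevé equation with parameter m: w_m″ = 2·w_m³ + X·w_m + m. -/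
open Polynomial

section DifferentialField

variable {K : Type*} [Field K] (d : Derivation ℤ K K)

/-- The Toda-type recurrence, written with the logarithmic derivative `h = f′/f`. -/
theorem toda_logDeriv {x f e g h : K} (hf : d f = h * f)
    (hrec : e * g = x * f ^ 2 - 4 * (f * d (d f) - d f ^ 2)) :
    e * g = (x - 4 * d h) * f ^ 2 := by
  rw [hrec, hf, d.leibniz, hf]
  simp only [smul_eq_mul]
  ring

/-- The logarithmic derivative of `T = e * g / f ^ 2`. -/
theorem deriv_eq_of_mul_eq_mul_sq {T f e g h h₀ h₁ : K} (hf0 : f ≠ 0)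
    (hf : d f = h * f) (hg : d g = h₀ * g) (he : d e = h₁ * e) (hT : e * g = T * f ^ 2) :
    d T = (h₁ + h₀ - 2 * h) * T := by
  have key := congrArg d hT
  simp only [d.leibniz, pow_two, smul_eq_mul, hf, hg, he] at key
  apply mul_right_cancel₀ (pow_ne_zero 2 hf0)
  linear_combination -key + (h₀ + h₁) * hT

/-- One Bäcklund step for the second Painlevé equation: the equation and the bilinear relation
`h′ + h₀′ + (h₀ - h) ^ 2 = 0` pass from `h₀ - h` to `h - h₁`. -/
theorem painleveII_backlund_step [CharZero K] {x T h h₀ h₁ a : K} (hx : d x = 1) (ha : d a = 0)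
    (hT0 : T ≠ 0) (hT : T = x - 4 * d h) (hdT : d T = (h₁ + h₀ - 2 * h) * T)
    (hbil : d h + d h₀ + (h₀ - h) ^ 2 = 0)
    (hP : d (d (h₀ - h)) = 2 * (h₀ - h) ^ 3 + x * (h₀ - h) + a) :
    d h₁ + d h + (h - h₁) ^ 2 = 0 ∧
      d (d (h - h₁)) = 2 * (h - h₁) ^ 3 + x * (h - h₁) + (a + 1) := by
  obtain ⟨w, hw⟩ : ∃ w, w = h₀ - h := ⟨_, rfl⟩
  obtain ⟨v, hv⟩ : ∃ v, v = h - h₁ := ⟨_, rfl⟩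
  have hdw : d w = d h₀ - d h := by rw [hw, map_sub]
  have hdv : d v = d h - d h₁ := by rw [hv, map_sub]
  rw [← hw] at hbil hP
  rw [← hv]
  have two : d (2 : K) = 0 := by exact_mod_cast d.map_natCast 2
  have one : d (1 : K) = 0 := d.map_one_eq_zero
  have hdT' : d T = (w - v) * T := by rw [hdT, hw, hv]; ring
  have hTw : T = x + 2 * (w * w) + 2 * d w := by linear_combination hT - 2 * hbil - 2 * hdw
  have hsum : (w + v) * T = -(2 * a + 1) := by
    have key := congrArg d hTw
    simp only [map_add, d.leibniz, smul_eq_mul, two, hx] at key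
    linear_combination -key + hdT' + 2 * w * hTw - 2 * hP
  have hric : d w + d v + w ^ 2 - v ^ 2 = 0 := by
    have key := congrArg d hsum
    simp only [map_add, map_neg, d.leibniz, smul_eq_mul, two, one, ha] at key
    apply mul_right_cancel₀ hT0
    linear_combination key - (w + v) * hdT'
  have hTv : T = x + 2 * (v * v) - 2 * d v := by linear_combination hTw + 2 * hric
  refine ⟨by linear_combination hbil - hric + hdw + hdv, ?_⟩
  have key := congrArg d hTv
  simp only [map_add, map_sub, d.leibniz, smul_eq_mul, two, hx] at key
  apply mul_left_cancel₀ (two_ne_zero (α := K))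
  linear_combination key - hdT' - hsum + 2 * v * hTv

/-- Solutions of the Yablonskii–Vorobiev recurrence in a differential field satisfy the bilinear
relation and yield solutions of the second Painlevé equation. -/
theorem painleveII_of_yablonskiiVorobiev [CharZero K] {x : K} (hx : d x = 1) (f h : ℕ → K)
    (hne : ∀ m, f m ≠ 0) (hf : ∀ m, d (f m) = h m * f m) (h0 : f 0 = 1) (h1 : f 1 = x)
    (hrec : ∀ m, f (m + 2) * f m =
      x * f (m + 1) ^ 2 - 4 * (f (m + 1) * d (d (f (m + 1))) - d (f (m + 1)) ^ 2)) (m : ℕ) :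
    d (h (m + 1)) + d (h m) + (h m - h (m + 1)) ^ 2 = 0 ∧
      d (d (h m - h (m + 1))) =
        2 * (h m - h (m + 1)) ^ 3 + x * (h m - h (m + 1)) + ((m + 1 : ℕ) : K) := by
  induction m with
  | zero =>
    have hx0 : x ≠ 0 := h1 ▸ hne 1
    have e0 : h 0 = 0 := by simpa [h0] using (hf 0).symm
    have e1 : h 1 * x = 1 := by simpa [h1, hx] using (hf 1).symm
    have de1 : d (h 1) = -h 1 ^ 2 := by
      have key := congrArg d e1
      simp only [d.leibniz, smul_eq_mul, hx, d.map_one_eq_zero] at key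
      linear_combination h 1 * key - d (h 1) * e1
    simp only [zero_add, e0, zero_sub, map_neg, map_zero, de1, d.leibniz, pow_two, smul_eq_mul]
    refine ⟨by ring, ?_⟩
    push_cast
    linear_combination e1
  | succ m ih =>
    have hT := toda_logDeriv d (hf (m + 1)) (hrec m)
    have hT0 : x - 4 * d (h (m + 1)) ≠ 0 := fun h0 ↦
      mul_ne_zero (hne (m + 2)) (hne m) (by rw [hT, h0, zero_mul])
    have hdT := deriv_eq_of_mul_eq_mul_sq d (hne (m + 1)) (hf (m + 1)) (hf m) (hf (m + 2)) hT
    have step := painleveII_backlund_step d hx (d.map_natCast (m + 1)) hT0 rfl hdT ih.1 ih.2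
    exact_mod_cast step

end DifferentialField

theorem exists_derivation_of_leibniz {K : Type*} [Field K] (D : K → K)
    (hadd : ∀ x y, D (x + y) = D x + D y) (hmul : ∀ x y, D (x * y) = x * D y + D x * y) :
    ∃ d : Derivation ℤ K K, ∀ x, d x = D x :=
  ⟨Derivation.mk' (AddMonoidHom.mk' D hadd).toIntLinearMap fun a b ↦ by
    simpa [mul_comm] using hmul a b, fun _ ↦ rfl⟩

/-- Rational solutions of the second Painlevé equation from
Yablonskii–Vorobiev polynomials: `w_m = u_{m−1}′/u_{m−1} − u_m′/u_m`
solves `w″ = 2w³ + X·w + m`. -/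
theorem PII_rational_solutions_from_YV (u : ℕ → Polynomial ℂ)
    (hne : ∀ m, u m ≠ 0)
    (h0 : u 0 = 1) (h1 : u 1 = X)
    (hrec : ∀ m : ℕ, 1 ≤ m →
      u (m + 1) * u (m - 1) =
        X * (u m) ^ 2 -
          4 * (u m * derivative (derivative (u m)) - (derivative (u m)) ^ 2))
    (D : RatFunc ℂ → RatFunc ℂ)
    (hD_add : ∀ x y : RatFunc ℂ, D (x + y) = D x + D y)
    (hD_mul : ∀ x y : RatFunc ℂ, D (x * y) = x * D y + D x * y)
    (hD_poly : ∀ p : Polynomial ℂ,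
      D (algebraMap (Polynomial ℂ) (RatFunc ℂ) p) =
        algebraMap (Polynomial ℂ) (RatFunc ℂ) (derivative p)) :
    ∀ m : ℕ, 1 ≤ m →
      let w : RatFunc ℂ :=
        algebraMap (Polynomial ℂ) (RatFunc ℂ) (derivative (u (m - 1))) /
            algebraMap (Polynomial ℂ) (RatFunc ℂ) (u (m - 1)) -
          algebraMap (Polynomial ℂ) (RatFunc ℂ) (derivative (u m)) /
            algebraMap (Polynomial ℂ) (RatFunc ℂ) (u m)
      D (D w) = 2 * w ^ 3 + RatFunc.X * w + (m : RatFunc ℂ) := by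
  obtain ⟨d, hd⟩ := exists_derivation_of_leibniz D hD_add hD_mul
  let φ := algebraMap ℂ[X] (RatFunc ℂ)
  have hφ : ∀ p, d (φ p) = φ (derivative p) := fun p ↦ (hd _).trans (hD_poly p)
  have hne' : ∀ m, φ (u m) ≠ 0 := fun m ↦ RatFunc.algebraMap_ne_zero (hne m)
  have hx : d (φ X) = 1 := by rw [hφ, derivative_X, map_one]
  intro m hm
  obtain ⟨n, rfl⟩ := Nat.exists_eq_add_of_le' hm
  have main := painleveII_of_yablonskiiVorobiev d hx (fun m ↦ φ (u m))
    (fun m ↦ φ (derivative (u m)) / φ (u m)) hne'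
    (fun m ↦ by rw [hφ, div_mul_cancel₀ _ (hne' m)]) (by simp [h0]) (by simp [h1])
    (fun m ↦ by
      simp only [hφ]
      simpa [show φ 4 = 4 from map_ofNat φ 4] using congrArg φ (hrec (m + 1) (by lia))) n
  rw [← RatFunc.algebraMap_X]
  simpa only [hd, Nat.add_sub_cancel] using main.2
end

section
/- Let u : ℕ → ℂ[X] be a sequence of nonzero polynomials with u₀ = 1, u₁ = X, satisfying the Yablonskii–Vorobiev recurrence u_{m+1}·u_{m−1} = X·u_m² − 4(u_m·u_m″ − (u_m′)²) for all m ≥ 1. Then for all m ≥ 1 the Hirota bilinear relation u_{m+1}′·u_{m−1} − u_{m+1}·u_{m−1}′ = (2m+1)·u_m² holds in ℂ[X]. -/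
open Polynomial

/-- Propagation of the first Hirota relation along the Yablonskii–Vorobiev recurrence: if the
second bilinear relation `D_z² r·q = 0` holds, then `D_z r·p = c q²` implies
`D_z s·q = (c + 2) r²`. -/
lemma hirota_first_step {p q r s c : ℂ[X]} (hq : q ≠ 0) (hr : r ≠ 0)
    (hrp : r * p = X * q ^ 2 - 4 * (q * derivative (derivative q) - derivative q ^ 2))
    (hsq : s * q = X * r ^ 2 - 4 * (r * derivative (derivative r) - derivative r ^ 2))
    (hfirst : derivative r * p - r * derivative p = c * q ^ 2)
    (hsecond : derivative (derivative r) * q - 2 * (derivative r * derivative q)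
      + r * derivative (derivative q) = 0) :
    derivative s * q - s * derivative q = (c + 2) * r ^ 2 := by
  have hrp' := congrArg derivative hrp
  have hsq' := congrArg derivative hsq
  have hsecond' := congrArg derivative hsecond
  simp only [derivative_mul, derivative_sub, derivative_add, derivative_X, derivative_sq,
    derivative_ofNat, derivative_zero, map_ofNat] at hrp' hsq' hsecond'
  refine mul_left_cancel₀ (mul_ne_zero (pow_ne_zero 3 hq) hr) ?_
  linear_combination q ^ 2 * r * (q * hsq' - 2 * derivative q * hsq)
    - r ^ 2 * q * (2 * derivative r * hrp - r * hrp') + q * r ^ 3 * hfirst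
    - 4 * q * r * (q * r * hsecond' - (derivative q * r + q * derivative r) * hsecond)

/-- Propagation of the second bilinear relation `D_z² r·q = 0` to `D_z² s·r = 0`, given
`D_z s·q = c r²` with `c` constant. -/
lemma hirota_second_step {q r s c : ℂ[X]} (hq : q ≠ 0) (hc : derivative c = 0)
    (hfirst : derivative s * q - s * derivative q = c * r ^ 2)
    (hsecond : derivative (derivative r) * q - 2 * (derivative r * derivative q)
      + r * derivative (derivative q) = 0) :
    derivative (derivative s) * r - 2 * (derivative s * derivative r)
      + s * derivative (derivative r) = 0 := by
  have hfirst' := congrArg derivative hfirst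
  simp only [derivative_mul, derivative_sub, derivative_sq, hc, map_ofNat] at hfirst'
  refine mul_left_cancel₀ hq ?_
  linear_combination s * hsecond + r * hfirst' - 2 * derivative r * hfirst

/-- First Hirota bilinear relation for the Yablonskii–Vorobiev polynomials:
`D_z u_{m+1}·u_{m−1} = (2m+1)·u_m²`. -/
theorem YV_hirota_first (u : ℕ → Polynomial ℂ)
    (hne : ∀ m, u m ≠ 0)
    (h0 : u 0 = 1) (h1 : u 1 = X)
    (hrec : ∀ m : ℕ, 1 ≤ m →
      u (m + 1) * u (m - 1) =
        X * (u m) ^ 2 -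
          4 * (u m * derivative (derivative (u m)) - (derivative (u m)) ^ 2)) :
    ∀ m : ℕ, 1 ≤ m →
      derivative (u (m + 1)) * u (m - 1) - u (m + 1) * derivative (u (m - 1)) =
        ((2 * m + 1 : ℕ) : Polynomial ℂ) * (u m) ^ 2 := by
  suffices h : ∀ m : ℕ, 1 ≤ m →
      derivative (u (m + 1)) * u (m - 1) - u (m + 1) * derivative (u (m - 1)) =
        ((2 * m + 1 : ℕ) : Polynomial ℂ) * (u m) ^ 2 ∧
      derivative (derivative (u (m + 1))) * u m - 2 * (derivative (u (m + 1)) * derivative (u m))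
        + u (m + 1) * derivative (derivative (u m)) = 0 from fun m hm => (h m hm).1
  intro m hm
  induction m, hm using Nat.le_induction with
  | base =>
    have h2 : u 2 = X ^ 3 + 4 := by
      have h := hrec 1 le_rfl
      norm_num [h0, h1] at h
      rw [h]
      ring
    constructor <;> simp [h0, h1, h2, map_ofNat C] <;> ring
  | succ m hm ih =>
    obtain ⟨hfirst, hsecond⟩ := ih
    have hnext : derivative (u (m + 2)) * u m - u (m + 2) * derivative (u m) =
        ((2 * (m + 1) + 1 : ℕ) : Polynomial ℂ) * u (m + 1) ^ 2 := by
      have h := hirota_first_step (hne m) (hne (m + 1)) (hrec m hm)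
        (hrec (m + 1) (Nat.le_add_left 1 m)) hfirst hsecond
      rw [show 2 * (m + 1) + 1 = 2 * m + 1 + 2 by ring, Nat.cast_add, Nat.cast_ofNat]
      exact h
    exact ⟨hnext, hirota_second_step (hne m) derivative_natCast hnext hsecond⟩
end

section
/- Let u : ℕ → ℂ[X] be a sequence of nonzero polynomials with u₀ = 1, u₁ = X, satisfying the Yablonskii–Vorobiev recurrence u_{m+1}·u_{m−1} = X·u_m² − 4(u_m·u_m″ − (u_m′)²) for all m ≥ 1. Then for all m ≥ 0 the Hirota bilinear relation u_{m+1}″·u_m − 2·u_{m+1}′·u_m′ + u_{m+1}·u_m″ = 0 holds in ℂ[X]. -/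
open Polynomial

/-- One step of the Yablonskii–Vorobiev recurrence preserves the pair of bilinear relations
`D_z² g·f = 0` and `(D_z³ - z D_z - c) g·f = 0`, with `c` replaced by `c - 1`. -/
theorem YV_bilinear_step {R : Type*} [CommRing R] [IsDomain R] {f g h : R[X]} (c : R)
    (hf : f ≠ 0)
    (hrec : h * f = X * g ^ 2 -
      4 * (g * derivative (derivative g) - derivative g ^ 2))
    (h2 : derivative (derivative g) * f - 2 * derivative g * derivative f +
      g * derivative (derivative f) = 0)
    (h3 : derivative (derivative (derivative g)) * f -
        3 * derivative (derivative g) * derivative f +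
        3 * derivative g * derivative (derivative f) -
        g * derivative (derivative (derivative f)) =
      X * (derivative g * f - g * derivative f) + C c * (f * g)) :
    derivative (derivative h) * g - 2 * derivative h * derivative g +
        h * derivative (derivative g) = 0 ∧
      derivative (derivative (derivative h)) * g -
          3 * derivative (derivative h) * derivative g +
          3 * derivative h * derivative (derivative g) -
          h * derivative (derivative (derivative g)) =
        X * (derivative h * g - h * derivative g) + C (c - 1) * (g * h) := by
  have hrec' := congrArg derivative hrec
  have h2' := congrArg derivative h2
  simp only [derivative_mul, derivative_add, derivative_sub, derivative_X, derivative_ofNat,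
    derivative_zero, pow_two] at hrec' h2'
  have hw : derivative h * f - h * derivative f = C (1 - 2 * c) * g ^ 2 := by
    refine mul_left_cancel₀ hf ?_
    simp only [C_sub, C_mul, C_1, C_ofNat]
    linear_combination f * hrec' - 2 * derivative f * hrec - 2 * g * (h3 + h2') +
      4 * derivative g * h2
  have hw' := congrArg derivative hw
  simp only [derivative_mul, derivative_sub, derivative_C, pow_two] at hw'
  have hw'' := congrArg derivative hw'
  simp only [derivative_mul, derivative_add, derivative_sub, derivative_C,
    derivative_zero] at hw''
  simp only [C_sub, C_mul, C_1, C_ofNat] at hw hw' hw'' ⊢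
  have hthird : derivative (derivative (derivative h)) * f =
      h * derivative (derivative (derivative f)) +
        (1 - 2 * C c) * (2 * derivative g ^ 2 + g * derivative (derivative g)) := by
    refine mul_left_cancel₀ hf ?_
    linear_combination f * hw'' - derivative f * hw' + derivative (derivative f) * hw +
      (1 - 2 * C c) * g * h2
  constructor
  · refine mul_left_cancel₀ hf ?_
    linear_combination g * hw' - 2 * derivative g * hw + h * h2
  · refine mul_left_cancel₀ hf ?_
    linear_combination g * hthird - 3 * derivative g * hw' +
      3 * derivative (derivative g) * hw - h * h3 - X * g * hw + (1 - 2 * C c) * g * hrec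

/-- Second Hirota bilinear relation for the Yablonskii–Vorobiev polynomials:
`D_z² u_{m+1}·u_m = 0`. -/
theorem YV_hirota_second (u : ℕ → Polynomial ℂ)
    (hne : ∀ m, u m ≠ 0)
    (h0 : u 0 = 1) (h1 : u 1 = X)
    (hrec : ∀ m : ℕ, 1 ≤ m →
      u (m + 1) * u (m - 1) =
        X * (u m) ^ 2 -
          4 * (u m * derivative (derivative (u m)) - (derivative (u m)) ^ 2)) :
    ∀ m : ℕ,
      derivative (derivative (u (m + 1))) * u m -
          2 * derivative (u (m + 1)) * derivative (u m) +
          u (m + 1) * derivative (derivative (u m)) = 0 := by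
  have key : ∀ m : ℕ,
      derivative (derivative (u (m + 1))) * u m -
          2 * derivative (u (m + 1)) * derivative (u m) +
          u (m + 1) * derivative (derivative (u m)) = 0 ∧
        derivative (derivative (derivative (u (m + 1)))) * u m -
            3 * derivative (derivative (u (m + 1))) * derivative (u m) +
            3 * derivative (u (m + 1)) * derivative (derivative (u m)) -
            u (m + 1) * derivative (derivative (derivative (u m))) =
          X * (derivative (u (m + 1)) * u m - u (m + 1) * derivative (u m)) +
            C (-(m : ℂ) - 1) * (u m * u (m + 1)) := by
    intro m
    induction m with
    | zero => simp [h0, h1]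
    | succ k ih =>
      have step := YV_bilinear_step _ (hne k) (hrec (k + 1) (by omega)) ih.1 ih.2
      have hc : -((k + 1 : ℕ) : ℂ) - 1 = -(k : ℂ) - 1 - 1 := by push_cast; ring
      rw [hc]
      exact step
  exact fun m => (key m).1
end

section
/- Fix t₁ ∈ ℂ. Let u : ℕ → ℂ[X] be a sequence of nonzero polynomials with u₀ = 1, u₁ = X, satisfying the generalized Yablonskii–Vorobiev recurrence u_{m+1}·u_{m−1} = X·u_m² − 4(u_m·u_m⁗ − 4·u_m′·u_m‴ + 3·(u_m″)²) − 4t₁·(u_m·u_m″ − (u_m′)²) for all m ≥ 1. Then for every m ≥ 1 the rational function w_m := u_{m−1}′/u_{m−1} − u_m′/u_m ∈ ℂ(X) satisfies the second member of the non-stationary second Painlevé hierarchy with parameter m: w_m⁗ − 10·w_m²·w_m″ − 10·w_m·(w_m′)² + 6·w_m⁵ + t₁·(w_m″ − 2·w_m³) = X·w_m + m. -/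
open Polynomial

namespace PainleveHierarchy

variable {k K : Type*} [CommRing k] [Field K] [Algebra k K]

/-- The second member of the second Painlevé hierarchy, written as its left-hand side minus
`z * w`, over a field with derivation `D`. -/
def operator (D : Derivation k K K) (t z w : K) : K :=
  D (D (D (D w))) - 10 * w ^ 2 * D (D w) - 10 * w * (D w) ^ 2 + 6 * w ^ 5 +
    t * (D (D w) - 2 * w ^ 3) - z * w

/-- The sum of the first two Lenard differential polynomials, `v'' + 3 v ^ 2 + t v`. -/
def lenard (D : Derivation k K K) (t v : K) : K :=
  D (D v) + 3 * v ^ 2 + t * v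

lemma derivation_ofNat (D : Derivation k K K) (n : ℕ) [n.AtLeastTwo] :
    D (ofNat(n) : K) = 0 :=
  D.map_natCast n

/-- Factorization of the operator through the Miura transformation `w ↦ w' - w ^ 2`. -/
lemma operator_eq_miura (D : Derivation k K K) {t : K} (ht : D t = 0) (z w : K) :
    operator D t z w =
      D (lenard D t (D w - w ^ 2)) + 2 * w * lenard D t (D w - w ^ 2) - z * w := by
  simp only [operator, lenard, pow_succ, pow_zero, one_mul, map_add, map_sub,
    Derivation.leibniz, smul_eq_mul, ht, derivation_ofNat, mul_zero, add_zero]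
  ring

lemma operator_neg (D : Derivation k K K) (t z w : K) :
    operator D t z (-w) = -operator D t z w := by
  simp only [operator, map_neg]
  ring

/-- The Bäcklund transformation raising the parameter by one, in terms of the logarithmic
derivatives `a`, `b`, `c` of three consecutive tau functions. -/
lemma backlund [CharZero K] (D : Derivation k K K) {t z a b c R α : K} (ht : D t = 0)
    (hz : D z = 1) (hα : D α = 0) (hR : R ≠ 0)
    (hRb : R = z - 4 * D (D (D b)) - 24 * (D b) ^ 2 - 4 * t * D b)
    (hDR : D R = R * (a + c - 2 * b)) (hab : D a + D b + (a - b) ^ 2 = 0)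
    (hw : operator D t z (a - b) = α) :
    D b + D c + (b - c) ^ 2 = 0 ∧ operator D t z (b - c) = α + 1 := by
  have hL : lenard D t (2 * D b) = (z - R) / 2 := by
    rw [hRb, lenard]
    simp only [Derivation.leibniz, smul_eq_mul, derivation_ofNat, mul_zero, add_zero]
    ring
  have hDL : D ((z - R) / 2) = (1 - R * (a + c - 2 * b)) / 2 := by
    have h : D (2 * ((z - R) / 2)) = 1 - R * (a + c - 2 * b) := by
      rw [mul_div_cancel₀ _ two_ne_zero, map_sub, hz, hDR]
    simp only [Derivation.leibniz, smul_eq_mul, derivation_ofNat, mul_zero, add_zero] at h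
    rw [← h]
    ring
  have hRac : R * (c - a) = 2 * α + 1 := by
    have hv : D (-(a - b)) - (-(a - b)) ^ 2 = 2 * D b := by
      rw [map_neg, map_sub]
      linear_combination -hab
    have h := operator_eq_miura D ht z (-(a - b))
    rw [operator_neg, hw, hv, hL, hDL] at h
    linear_combination 2 * h
  have hca : D c - D a = -(c - a) * (a + c - 2 * b) := by
    have h := congrArg D hRac
    simp only [Derivation.leibniz, smul_eq_mul, map_add, map_sub, derivation_ofNat, hα, hDR,
      Derivation.map_one_eq_zero, mul_zero, add_zero] at h
    apply mul_left_cancel₀ hR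
    linear_combination h
  have hbc : D b + D c + (b - c) ^ 2 = 0 := by
    linear_combination hab + hca
  refine ⟨hbc, ?_⟩
  have hv : D (b - c) - (b - c) ^ 2 = 2 * D b := by
    rw [map_sub]
    linear_combination -hbc
  rw [operator_eq_miura D ht, hv, hL, hDL]
  linear_combination hRac / 2

/-- The quadratic expression of the generalized Yablonskii–Vorobiev recurrence in terms of
logarithmic derivatives. -/
lemma yablonskiiVorobiev_eq (D : Derivation k K K) (t z : K) {g : K} (hg : g ≠ 0) :
    z * g ^ 2 - 4 * (g * D (D (D (D g))) - 4 * D g * D (D (D g)) + 3 * (D (D g)) ^ 2) -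
        4 * t * (g * D (D g) - (D g) ^ 2) =
      g ^ 2 * (z - 4 * D (D (D (D g / g))) - 24 * (D (D g / g)) ^ 2 -
        4 * t * D (D g / g)) := by
  have h1 : D g = g * (D g / g) := (mul_div_cancel₀ _ hg).symm
  generalize D g / g = b at *
  simp only [h1, pow_succ, pow_zero, one_mul, map_add, Derivation.leibniz, smul_eq_mul]
  ring

/-- The Bäcklund transformation for three consecutive tau functions `f`, `g`, `h`. -/
lemma backlund_tau [CharZero K] (D : Derivation k K K) {t z f g h α : K} (ht : D t = 0)
    (hz : D z = 1) (hα : D α = 0) (hf : f ≠ 0) (hg : g ≠ 0) (hh : h ≠ 0)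
    (hrec : h * f =
      z * g ^ 2 - 4 * (g * D (D (D (D g))) - 4 * D g * D (D (D g)) + 3 * (D (D g)) ^ 2) -
        4 * t * (g * D (D g) - (D g) ^ 2))
    (hfg : D (D f / f) + D (D g / g) + (D f / f - D g / g) ^ 2 = 0)
    (hw : operator D t z (D f / f - D g / g) = α) :
    D (D g / g) + D (D h / h) + (D g / g - D h / h) ^ 2 = 0 ∧
      operator D t z (D g / g - D h / h) = α + 1 := by
  refine backlund D (R := h * f / g ^ 2) ht hz hα (by positivity) ?_ ?_ hfg hw
  · rw [hrec, yablonskiiVorobiev_eq D t z hg, mul_div_cancel_left₀ _ (pow_ne_zero 2 hg)]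
  · have hquot : D (h * f / g ^ 2 * g ^ 2) = D (h * f) := by
      rw [div_mul_cancel₀ _ (pow_ne_zero 2 hg)]
    simp only [Derivation.leibniz, smul_eq_mul, pow_two] at hquot
    apply mul_left_cancel₀ (pow_ne_zero 2 hg)
    rw [pow_two]
    have hDquot : g * g * D (h * f / (g * g)) =
        h * D f + f * D h - h * f / (g * g) * (g * D g + g * D g) := by
      linear_combination hquot
    rw [hDquot]
    field_simp
    ring

end PainleveHierarchy

/-- Rational solutions of the second member of the non-stationary second
Painlevé hierarchy from the generalized Yablonskii–Vorobiev polynomials. -/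
theorem PII2_rational_solutions_from_YV (t₁ : ℂ) (u : ℕ → Polynomial ℂ)
    (hne : ∀ m, u m ≠ 0)
    (h0 : u 0 = 1) (h1 : u 1 = X)
    (hrec : ∀ m : ℕ, 1 ≤ m →
      u (m + 1) * u (m - 1) =
        X * (u m) ^ 2 -
          4 * (u m * derivative (derivative (derivative (derivative (u m)))) -
            4 * derivative (u m) * derivative (derivative (derivative (u m))) +
            3 * (derivative (derivative (u m))) ^ 2) -
          4 * Polynomial.C t₁ *
            (u m * derivative (derivative (u m)) - (derivative (u m)) ^ 2))
    (D : RatFunc ℂ → RatFunc ℂ)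
    (hD_add : ∀ x y : RatFunc ℂ, D (x + y) = D x + D y)
    (hD_mul : ∀ x y : RatFunc ℂ, D (x * y) = x * D y + D x * y)
    (hD_poly : ∀ p : Polynomial ℂ,
      D (algebraMap (Polynomial ℂ) (RatFunc ℂ) p) =
        algebraMap (Polynomial ℂ) (RatFunc ℂ) (derivative p)) :
    ∀ m : ℕ, 1 ≤ m →
      let w : RatFunc ℂ :=
        algebraMap (Polynomial ℂ) (RatFunc ℂ) (derivative (u (m - 1))) /
            algebraMap (Polynomial ℂ) (RatFunc ℂ) (u (m - 1)) -
          algebraMap (Polynomial ℂ) (RatFunc ℂ) (derivative (u m)) /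
            algebraMap (Polynomial ℂ) (RatFunc ℂ) (u m)
      D (D (D (D w))) - 10 * w ^ 2 * D (D w) - 10 * w * (D w) ^ 2 + 6 * w ^ 5 +
          RatFunc.C t₁ * (D (D w) - 2 * w ^ 3) =
        RatFunc.X * w + (m : RatFunc ℂ) := by
  let ι := algebraMap (Polynomial ℂ) (RatFunc ℂ)
  have hD_smul (c : ℂ) (x : RatFunc ℂ) : D (c • x) = c • D x := by
    rw [Algebra.smul_def, Algebra.smul_def, RatFunc.algebraMap_eq_C, hD_mul,
      ← RatFunc.algebraMap_C, hD_poly, derivative_C, map_zero, zero_mul, add_zero]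
  obtain ⟨E, hE⟩ : ∃ E : Derivation ℂ (RatFunc ℂ) (RatFunc ℂ), ∀ x, E x = D x :=
    ⟨Derivation.mk' { toFun := D, map_add' := hD_add, map_smul' := hD_smul } fun x y => by
      simp only [LinearMap.coe_mk, AddHom.coe_mk, smul_eq_mul, hD_mul, mul_comm y], fun _ => rfl⟩
  have hEι (p : Polynomial ℂ) : E (ι p) = ι (derivative p) := by rw [hE, hD_poly]
  have hι {p : Polynomial ℂ} (hp : p ≠ 0) : ι p ≠ 0 := RatFunc.algebraMap_ne_zero hp
  have hz : E RatFunc.X = 1 := by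
    rw [← RatFunc.algebraMap_X, hEι, derivative_X, map_one]
  have ht : E (RatFunc.C t₁) = 0 := by
    rw [← RatFunc.algebraMap_C, hEι, derivative_C, map_zero]
  have key (n : ℕ) :
      E (E (ι (u n)) / ι (u n)) + E (E (ι (u (n + 1))) / ι (u (n + 1))) +
          (E (ι (u n)) / ι (u n) - E (ι (u (n + 1))) / ι (u (n + 1))) ^ 2 = 0 ∧
        PainleveHierarchy.operator E (RatFunc.C t₁) RatFunc.X
          (E (ι (u n)) / ι (u n) - E (ι (u (n + 1))) / ι (u (n + 1))) = (n + 1 : ℕ) := by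
    induction n with
    | zero =>
      have hb : RatFunc.X * (1 / RatFunc.X : RatFunc ℂ) = 1 :=
        mul_one_div_cancel RatFunc.X_ne_zero
      have hDb : E (1 / RatFunc.X) = -(1 / RatFunc.X) ^ 2 := by
        have h := congrArg E hb
        simp only [Derivation.leibniz, smul_eq_mul, hz, Derivation.map_one_eq_zero] at h
        apply mul_left_cancel₀ (RatFunc.X_ne_zero (K := ℂ))
        linear_combination h + (1 / RatFunc.X) * hb
      have hι0 : ι (u 0) = 1 := by rw [h0, map_one]
      have hι1 : ι (u (0 + 1)) = RatFunc.X := by rw [zero_add, h1, RatFunc.algebraMap_X]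
      rw [hι0, hι1, Derivation.map_one_eq_zero, hz, zero_div, map_zero, zero_sub,
        PainleveHierarchy.operator_neg, PainleveHierarchy.operator]
      generalize (1 / RatFunc.X : RatFunc ℂ) = b at *
      simp only [hDb, pow_succ, pow_zero, one_mul, map_add, map_neg, Derivation.leibniz,
        smul_eq_mul, zero_add, Nat.cast_one]
      constructor
      · ring
      · linear_combination hb
    | succ n ih =>
      have hrec' := congrArg ι (hrec (n + 1) (Nat.le_add_left 1 n))
      have hstep := PainleveHierarchy.backlund_tau E (h := ι (u (n + 1 + 1))) ht hz
        (E.map_natCast (n + 1)) (hι (hne n)) (hι (hne _)) (hι (hne _)) ?_ ih.1 ih.2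
      · exact ⟨hstep.1, by rw [hstep.2]; push_cast; ring⟩
      · simp only [hEι, ← RatFunc.algebraMap_X, ← RatFunc.algebraMap_C]
        simpa only [map_mul, map_sub, map_add, map_pow, map_ofNat, Nat.add_sub_cancel] using hrec'
  intro m hm w
  obtain ⟨n, rfl⟩ := Nat.exists_eq_add_of_le' hm
  have h := (key n).2
  simp only [hEι, PainleveHierarchy.operator, hE] at h
  exact sub_eq_iff_eq_add'.mp h
end

section
/- Fix t₁ ∈ ℂ. Let u : ℕ → ℂ[X] be a sequence of nonzero polynomials with u₀ = 1, u₁ = X, satisfying the generalized Yablonskii–Vorobiev recurrence u_{m+1}·u_{m−1} = X·u_m² − 4(u_m·u_m⁗ − 4·u_m′·u_m‴ + 3·(u_m″)²) − 4t₁·(u_m·u_m″ − (u_m′)²) for all m ≥ 1. Then for all m ≥ 1 the Hirota bilinear relation u_{m+1}′·u_{m−1} − u_{m+1}·u_{m−1}′ = (2m+1)·u_m² holds in ℂ[X]. -/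
open Polynomial

/-- The right-hand side of the generalized Yablonskii–Vorobiev recurrence. -/
noncomputable def yvRhs {R : Type*} [CommRing R] (t : R) (f : R[X]) : R[X] :=
  X * f ^ 2 -
    4 * (f * derivative (derivative (derivative (derivative f))) -
      4 * derivative f * derivative (derivative (derivative f)) +
      3 * (derivative (derivative f)) ^ 2) -
    4 * C t * (f * derivative (derivative f) - (derivative f) ^ 2)

/-- The Hirota derivative `D² f·g`. -/
noncomputable def hirotaTwo {R : Type*} [CommRing R] (f g : R[X]) : R[X] :=
  derivative (derivative f) * g - 2 * derivative f * derivative g +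
    f * derivative (derivative g)

theorem derivative_yvRhs {R : Type*} [CommRing R] (t : R) (f : R[X]) :
    derivative (yvRhs t f) =
      f ^ 2 + 2 * X * f * derivative f -
        4 * (f * derivative (derivative (derivative (derivative (derivative f)))) -
          3 * derivative f * derivative (derivative (derivative (derivative f))) +
          2 * derivative (derivative f) * derivative (derivative (derivative f))) -
        4 * C t * (f * derivative (derivative (derivative f)) -
          derivative f * derivative (derivative f)) := by
  simp only [yvRhs, derivative_add, derivative_sub, derivative_mul, derivative_pow,
    derivative_X, derivative_C, derivative_ofNat, Nat.cast_ofNat, map_ofNat, Nat.reduceSub, pow_one]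
  ring

theorem yvRhs_exchange {R : Type*} [CommRing R] (t : R) {f g : R[X]}
    (h : hirotaTwo g f = 0) :
    f * (f * derivative (yvRhs t g) - 2 * derivative f * yvRhs t g) +
      g * (g * derivative (yvRhs t f) - 2 * derivative g * yvRhs t f) =
    2 * f ^ 2 * g ^ 2 := by
  unfold hirotaTwo at h
  have h₁ := congrArg derivative h
  have h₂ := congrArg derivative h₁
  have h₃ := congrArg derivative h₂
  simp only [derivative_add, derivative_sub, derivative_mul, derivative_ofNat,
    derivative_zero, zero_mul, zero_add] at h₁ h₂ h₃
  rw [derivative_yvRhs, derivative_yvRhs]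
  unfold yvRhs
  linear_combination
    (-8 * f * derivative (derivative (derivative g)) +
      24 * derivative f * derivative (derivative g) +
      24 * derivative (derivative f) * derivative g -
      8 * derivative (derivative (derivative f)) * g +
      4 * C t * (f * derivative g + derivative f * g)) * h -
    (48 * derivative f * derivative g + 4 * C t * f * g) * h₁ +
    12 * (f * derivative g + derivative f * g) * h₂ - 4 * f * g * h₃

theorem hirotaTwo_eq_zero_step {R : Type*} [CommRing R] [IsDomain R] {c : ℕ} {f g h : R[X]}
    (hh : h ≠ 0) (hA : hirotaTwo f h = 0)
    (hB : derivative g * h - g * derivative h = (c : R[X]) * f ^ 2) :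
    hirotaTwo g f = 0 := by
  have hB' := congrArg derivative hB
  simp only [derivative_sub, derivative_mul, derivative_pow, derivative_natCast,
    zero_mul, zero_add, Nat.cast_ofNat, map_ofNat, Nat.reduceSub, pow_one] at hB'
  refine (mul_eq_zero.mp ?_).resolve_left hh
  unfold hirotaTwo at hA ⊢
  linear_combination f * hB' - 2 * derivative f * hB + g * hA

theorem hirota_first_step_s12 {R : Type*} [CommRing R] [IsDomain R] {t : R} {c : ℕ}
    {f g h k : R[X]} (hf : f ≠ 0) (hA : hirotaTwo g f = 0)
    (hB : derivative g * h - g * derivative h = (c : R[X]) * f ^ 2)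
    (hg : g * h = yvRhs t f) (hk : k * f = yvRhs t g) :
    derivative k * f - k * derivative f = ((c + 2 : ℕ) : R[X]) * g ^ 2 := by
  have key := yvRhs_exchange t hA
  rw [← hg, ← hk, derivative_mul, derivative_mul] at key
  push_cast
  refine mul_left_cancel₀ (pow_ne_zero 2 hf) ?_
  linear_combination key + g ^ 2 * hB

/-- First Hirota bilinear relation for the generalized Yablonskii–Vorobiev
polynomials: `D_z u_{m+1}·u_{m−1} = (2m+1)·u_m²`. -/
theorem YV2_hirota_first (t₁ : ℂ) (u : ℕ → Polynomial ℂ)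
    (hne : ∀ m, u m ≠ 0)
    (h0 : u 0 = 1) (h1 : u 1 = X)
    (hrec : ∀ m : ℕ, 1 ≤ m →
      u (m + 1) * u (m - 1) =
        X * (u m) ^ 2 -
          4 * (u m * derivative (derivative (derivative (derivative (u m)))) -
            4 * derivative (u m) * derivative (derivative (derivative (u m))) +
            3 * (derivative (derivative (u m))) ^ 2) -
          4 * Polynomial.C t₁ *
            (u m * derivative (derivative (u m)) - (derivative (u m)) ^ 2)) :
    ∀ m : ℕ, 1 ≤ m →
      derivative (u (m + 1)) * u (m - 1) - u (m + 1) * derivative (u (m - 1)) =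
        ((2 * m + 1 : ℕ) : Polynomial ℂ) * (u m) ^ 2 := by
  have main : ∀ n : ℕ, hirotaTwo (u (n + 1)) (u n) = 0 ∧
      derivative (u (n + 2)) * u n - u (n + 2) * derivative (u n) =
        ((2 * (n + 1) + 1 : ℕ) : Polynomial ℂ) * (u (n + 1)) ^ 2 := by
    intro n
    induction n with
    | zero =>
      have h2 := hrec 1 le_rfl
      simp only [Nat.reduceAdd, Nat.sub_self, h0, h1, mul_one, derivative_X, derivative_one,
        derivative_zero] at h2
      refine ⟨by simp [hirotaTwo, h0, h1], ?_⟩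
      simp only [Nat.reduceAdd, Nat.reduceMul, zero_add, h0, h1, h2]
      simp
      ring
    | succ n ih =>
      have hA := hirotaTwo_eq_zero_step (hne n) ih.1 ih.2
      exact ⟨hA, hirota_first_step_s12 (hne (n + 1)) hA ih.2 (hrec (n + 1) n.succ_pos)
        (hrec (n + 2) (n + 1).succ_pos)⟩
  intro m hm
  obtain ⟨n, rfl⟩ := Nat.exists_eq_add_of_le' hm
  exact (main n).2
end

section
/- Fix t₁ ∈ ℂ. Let u : ℕ → ℂ[X] be a sequence of nonzero polynomials with u₀ = 1, u₁ = X, satisfying the generalized Yablonskii–Vorobiev recurrence u_{m+1}·u_{m−1} = X·u_m² − 4(u_m·u_m⁗ − 4·u_m′·u_m‴ + 3·(u_m″)²) − 4t₁·(u_m·u_m″ − (u_m′)²) for all m ≥ 1. Then for all m ≥ 0 the Hirota bilinear relation u_{m+1}″·u_m − 2·u_{m+1}′·u_m′ + u_{m+1}·u_m″ = 0 holds in ℂ[X]. -/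
open Polynomial

namespace YablonskiiVorobiev

/-- A Hirota relation for `a, b` and a Wronskian relation for `c, a` give the Hirota relation
for `b, c`. -/
lemma hirota_succ {k : ℂ} {a b c : ℂ[X]} (ha : a ≠ 0)
    (hH : derivative (derivative b) * a - 2 * derivative b * derivative a +
      b * derivative (derivative a) = 0)
    (hW : derivative c * a - c * derivative a = C k * b ^ 2) :
    derivative (derivative c) * b - 2 * derivative c * derivative b +
      c * derivative (derivative b) = 0 := by
  have hW' := congrArg derivative hW
  simp only [derivative_sub, derivative_mul, derivative_pow, derivative_C] at hW'
  apply mul_left_cancel₀ ha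
  push_cast at hW'
  simp only [map_ofNat] at hW'
  linear_combination c * hH + b * hW' - 2 * derivative b * hW

/-- If `b, c` satisfy the Hirota relation, the recurrence carries the Wronskian relation for `c, a`
to one for `d, b`. -/
lemma wronskian_succ {t k : ℂ} {a b c d : ℂ[X]} (hb : b ≠ 0)
    (hH : derivative (derivative c) * b - 2 * derivative c * derivative b +
      c * derivative (derivative b) = 0)
    (hW : derivative c * a - c * derivative a = C k * b ^ 2)
    (hca : c * a = X * b ^ 2 -
      4 * (b * derivative (derivative (derivative (derivative b))) -
        4 * derivative b * derivative (derivative (derivative b)) +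
        3 * (derivative (derivative b)) ^ 2) -
      4 * C t * (b * derivative (derivative b) - (derivative b) ^ 2))
    (hdb : d * b = X * c ^ 2 -
      4 * (c * derivative (derivative (derivative (derivative c))) -
        4 * derivative c * derivative (derivative (derivative c)) +
        3 * (derivative (derivative c)) ^ 2) -
      4 * C t * (c * derivative (derivative c) - (derivative c) ^ 2)) :
    derivative d * b - d * derivative b = C (k + 2) * c ^ 2 := by
  have hca' := congrArg derivative hca
  have hdb' := congrArg derivative hdb
  have hH1 := congrArg derivative hH
  have hH2 := congrArg (fun p => derivative (derivative p)) hH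
  have hH3 := congrArg (fun p => derivative (derivative (derivative p))) hH
  simp only [pow_two, derivative_sub, derivative_add, derivative_mul, derivative_C, derivative_X,
    derivative_ofNat, derivative_zero, zero_mul, mul_zero, zero_add, add_zero]
    at hca' hdb' hH1 hH2 hH3
  have hk : (C (k + 2) : ℂ[X]) = C k + 2 := by rw [C_add, map_ofNat]
  rw [hk]
  apply mul_left_cancel₀ (pow_ne_zero 2 hb)
  linear_combination b ^ 2 * hdb' - 2 * b * derivative b * hdb + c ^ 2 * hca' -
    2 * c * derivative c * hca + c ^ 2 * hW -
    4 * C t * (b * c * hH1 - (b * derivative c + derivative b * c) * hH) -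
    4 * ((2 * b * derivative (derivative (derivative c)) -
        6 * derivative b * derivative (derivative c) -
        6 * derivative (derivative b) * derivative c +
        2 * derivative (derivative (derivative b)) * c) * hH +
      12 * derivative b * derivative c * hH1 -
      3 * (b * derivative c + derivative b * c) * hH2 + b * c * hH3)

end YablonskiiVorobiev

/-- Second Hirota bilinear relation for the generalized Yablonskii–Vorobiev
polynomials: `D_z² u_{m+1}·u_m = 0`. -/
theorem YV2_hirota_second (t₁ : ℂ) (u : ℕ → Polynomial ℂ)
    (hne : ∀ m, u m ≠ 0)
    (h0 : u 0 = 1) (h1 : u 1 = X)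
    (hrec : ∀ m : ℕ, 1 ≤ m →
      u (m + 1) * u (m - 1) =
        X * (u m) ^ 2 -
          4 * (u m * derivative (derivative (derivative (derivative (u m)))) -
            4 * derivative (u m) * derivative (derivative (derivative (u m))) +
            3 * (derivative (derivative (u m))) ^ 2) -
          4 * Polynomial.C t₁ *
            (u m * derivative (derivative (u m)) - (derivative (u m)) ^ 2)) :
    ∀ m : ℕ,
      derivative (derivative (u (m + 1))) * u m -
          2 * derivative (u (m + 1)) * derivative (u m) +
          u (m + 1) * derivative (derivative (u m)) = 0 := by
  have hrec' (m : ℕ) := hrec (m + 1) (Nat.le_add_left 1 m)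
  simp only [Nat.add_sub_cancel] at hrec'
  suffices h : ∀ m : ℕ,
      (derivative (derivative (u (m + 1))) * u m - 2 * derivative (u (m + 1)) * derivative (u m) +
        u (m + 1) * derivative (derivative (u m)) = 0) ∧
      derivative (u (m + 2)) * u m - u (m + 2) * derivative (u m) =
        C (2 * m + 3 : ℂ) * u (m + 1) ^ 2 from fun m => (h m).1
  intro m
  induction m with
  | zero =>
    have h2 : u 2 = X ^ 3 + 4 * C t₁ := by
      have h := hrec' 0
      simp only [zero_add, h0, h1, mul_one, derivative_X, derivative_one, derivative_zero,
        Nat.reduceAdd] at h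
      linear_combination h
    simp only [h0, h1, h2, zero_add, derivative_add, derivative_mul, derivative_X_pow, derivative_C,
      derivative_ofNat, derivative_one, derivative_zero, derivative_X, CharP.cast_eq_zero, mul_zero,
      map_ofNat, Nat.cast_ofNat]
    refine ⟨by ring, by ring⟩
  | succ m ih =>
    obtain ⟨hH, hW⟩ := ih
    have hH' := YablonskiiVorobiev.hirota_succ (hne m) hH hW
    refine ⟨hH', ?_⟩
    rw [YablonskiiVorobiev.wronskian_succ (hne (m + 1)) hH' hW (hrec' m) (hrec' (m + 1))]
    congr 2
    push_cast
    ring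
end

section
/- Let α ∈ ℂ and let w ∈ ℂ(X) be a rational function satisfying the second Painlevé equation w″ = 2w³ + X·w + α. Then α is an integer. -/
open Polynomial

/-- Clearing denominators in the second Painlevé equation for the fraction `P / Q`. -/
theorem PII_polynomial_equation
    (D : RatFunc ℂ → RatFunc ℂ)
    (hD_add : ∀ x y : RatFunc ℂ, D (x + y) = D x + D y)
    (hD_mul : ∀ x y : RatFunc ℂ, D (x * y) = x * D y + D x * y)
    (hD_poly : ∀ p : ℂ[X],
      D (algebraMap ℂ[X] (RatFunc ℂ) p) = algebraMap ℂ[X] (RatFunc ℂ) (derivative p))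
    {α : ℂ} {w : RatFunc ℂ}
    (hw : D (D w) = 2 * w ^ 3 + RatFunc.X * w + RatFunc.C α) {P Q : ℂ[X]}
    (hwPQ : w * algebraMap ℂ[X] (RatFunc ℂ) Q = algebraMap ℂ[X] (RatFunc ℂ) P) :
    derivative (derivative P) * Q ^ 2 + 2 * P * derivative Q ^ 2
        - 2 * derivative P * derivative Q * Q - P * derivative (derivative Q) * Q =
      2 * P ^ 3 + X * P * Q ^ 2 + C α * Q ^ 3 := by
  apply RatFunc.algebraMap_injective ℂ
  simp only [map_add, map_sub, map_mul, map_pow, map_ofNat, RatFunc.algebraMap_X,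
    RatFunc.algebraMap_C]
  have h₁ := congrArg D hwPQ
  rw [hD_mul, hD_poly, hD_poly] at h₁
  have h₂ := congrArg D h₁
  rw [hD_add, hD_mul, hD_mul, hD_poly, hD_poly, hD_poly] at h₂
  rw [← h₂, ← h₁, ← hwPQ, hw]
  ring

/-- A polynomial of smaller degree than a monic `Q` with simple roots, whose quotient by `Q` has
residues `±1`, has an integral coefficient in degree `Q.natDegree - 1`. -/
theorem coeff_natDegree_sub_one_mem_int_of_residues {P Q : ℂ[X]} (hQ : Q.Monic)
    (hnodup : Q.roots.Nodup) (hdeg : P.degree < Q.degree)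
    (hres : ∀ a ∈ Q.roots, P.eval a ^ 2 = (derivative Q).eval a ^ 2) :
    ∃ m : ℤ, P.coeff (Q.natDegree - 1) = m := by
  classical
  have hcard : Q.roots.toFinset.card = Q.natDegree := by
    rw [Multiset.toFinset_card_of_nodup hnodup]
    exact ((IsAlgClosed.splits Q).natDegree_eq_card_roots).symm
  have hQnodal : Q = Lagrange.nodal Q.roots.toFinset id := by
    conv_lhs => rw [(IsAlgClosed.splits Q).eq_prod_roots_of_monic hQ]
    rw [Lagrange.nodal, Finset.prod, Multiset.toFinset_val, Multiset.dedup_eq_self.2 hnodup]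
    rfl
  have hP : P.degree < Q.roots.toFinset.card := by
    rwa [hcard, ← degree_eq_natDegree hQ.ne_zero]
  have hint : ∀ a ∈ Q.roots.toFinset, ∃ m : ℤ,
      P.eval a / ∏ b ∈ Q.roots.toFinset.erase a, (a - b) = m := by
    intro a ha
    have hder : (derivative Q).eval a = ∏ b ∈ Q.roots.toFinset.erase a, (a - b) := by
      have h := Lagrange.eval_nodal_derivative_eval_node_eq (v := (id : ℂ → ℂ)) ha
      rw [← hQnodal, Lagrange.eval_nodal] at h
      exact h
    have hne : (∏ b ∈ Q.roots.toFinset.erase a, (a - b)) ≠ 0 :=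
      Finset.prod_ne_zero_iff.2 fun b hb => sub_ne_zero.2 (Finset.ne_of_mem_erase hb).symm
    rcases sq_eq_sq_iff_eq_or_eq_neg.1 (hres a (Multiset.mem_toFinset.1 ha)) with h | h
    · exact ⟨1, by rw [h, hder, div_self hne, Int.cast_one]⟩
    · exact ⟨-1, by rw [h, hder, neg_div, div_self hne, Int.cast_neg, Int.cast_one]⟩
  choose! m hm using hint
  refine ⟨∑ a ∈ Q.roots.toFinset, m a, ?_⟩
  have hsum := Lagrange.coeff_eq_sum (v := (id : ℂ → ℂ)) Function.injective_id.injOn hP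
  rw [hcard] at hsum
  rw [hsum, Int.cast_sum]
  exact Finset.sum_congr rfl hm

theorem natDegree_PII_derivative_terms_le (P Q : ℂ[X]) :
    (derivative (derivative P) * Q ^ 2 + 2 * P * derivative Q ^ 2
        - 2 * derivative P * derivative Q * Q - P * derivative (derivative Q) * Q).natDegree ≤
      P.natDegree + 2 * Q.natDegree := by
  have hder (f : ℂ[X]) : (derivative f).natDegree ≤ f.natDegree :=
    (natDegree_derivative_le f).trans (Nat.sub_le _ _)
  have hP₁ := hder P
  have hP₂ := (hder (derivative P)).trans hP₁
  have hQ₁ := hder Q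
  have hQ₂ := (hder (derivative Q)).trans hQ₁
  have h2 : (2 : ℂ[X]).natDegree ≤ 0 := (natDegree_ofNat 2).le
  refine natDegree_sub_le_of_le (natDegree_sub_le_of_le (natDegree_add_le_of_degree_le ?_ ?_) ?_
    |>.trans (max_self _).le) ?_ |>.trans (max_self _).le
  · exact (natDegree_mul_le_of_le hP₂ (natDegree_pow_le_of_le 2 le_rfl))
  · exact (natDegree_mul_le_of_le (natDegree_mul_le_of_le h2 le_rfl)
      (natDegree_pow_le_of_le 2 hQ₁)).trans (by omega)
  · exact (natDegree_mul_le_of_le (natDegree_mul_le_of_le (natDegree_mul_le_of_le h2 hP₁) hQ₁)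
      le_rfl).trans (by omega)
  · exact (natDegree_mul_le_of_le (natDegree_mul_le_of_le le_rfl hQ₂) le_rfl).trans (by omega)

/-- A rational solution of the second Painlevé equation vanishes at infinity. -/
theorem degree_lt_of_PII_polynomial_equation {P Q : ℂ[X]} {α : ℂ} (hQ : Q.Monic)
    (heq : derivative (derivative P) * Q ^ 2 + 2 * P * derivative Q ^ 2
        - 2 * derivative P * derivative Q * Q - P * derivative (derivative Q) * Q =
      2 * P ^ 3 + X * P * Q ^ 2 + C α * Q ^ 3) :
    P.degree < Q.degree := by
  by_contra! hle
  have hP0 : P ≠ 0 := by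
    rintro rfl
    exact hQ.ne_zero (degree_eq_bot.1 (le_bot_iff.1 (by simpa using hle)))
  have hnat : Q.natDegree ≤ P.natDegree := natDegree_le_natDegree hle
  have hbound := natDegree_PII_derivative_terms_le P Q
  rw [heq] at hbound
  have hcube : (2 * P ^ 3 : ℂ[X]).natDegree = 3 * P.natDegree := by
    rw [natDegree_mul two_ne_zero (pow_ne_zero 3 hP0), natDegree_ofNat, natDegree_pow, zero_add]
  have hlin : (X * P * Q ^ 2).natDegree = 1 + P.natDegree + 2 * Q.natDegree := by
    rw [natDegree_mul (mul_ne_zero X_ne_zero hP0) (pow_ne_zero 2 hQ.ne_zero),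
      natDegree_mul X_ne_zero hP0, natDegree_X, natDegree_pow]
  have hconst : (C α * Q ^ 3).natDegree ≤ 3 * Q.natDegree :=
    (natDegree_C_mul_le _ _).trans (natDegree_pow_le_of_le 3 le_rfl)
  rcases hnat.lt_or_eq with hlt | heqdeg
  · rw [add_assoc, natDegree_add_eq_left_of_natDegree_lt, hcube] at hbound
    · omega
    · rw [hcube]
      exact (natDegree_add_le_of_degree_le (n := 1 + P.natDegree + 2 * Q.natDegree) hlin.le
        (hconst.trans (by omega))).trans_lt (by omega)
  · rw [add_right_comm, natDegree_add_eq_right_of_natDegree_lt, hlin] at hbound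
    · omega
    · rw [hlin]
      exact (natDegree_add_le_of_degree_le (n := 3 * P.natDegree) hcube.le
        (hconst.trans (by omega))).trans_lt (by omega)

/-- The parameter is determined by the behaviour of the solution at infinity. -/
theorem parameter_eq_neg_coeff_of_PII_polynomial_equation {P Q : ℂ[X]} {α : ℂ} (hQ : Q.Monic)
    (heq : derivative (derivative P) * Q ^ 2 + 2 * P * derivative Q ^ 2
        - 2 * derivative P * derivative Q * Q - P * derivative (derivative Q) * Q =
      2 * P ^ 3 + X * P * Q ^ 2 + C α * Q ^ 3)
    (hdeg : P.degree < Q.degree) :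
    α = -P.coeff (Q.natDegree - 1) := by
  rcases eq_or_ne P 0 with rfl | hP0
  · have h0 : C α * Q ^ 3 = 0 := by simpa using heq.symm
    simpa [hQ.ne_zero] using h0
  have hnat : P.natDegree < Q.natDegree := natDegree_lt_natDegree hP0 hdeg
  have hcoeff := congrArg (fun f => f.coeff (3 * Q.natDegree)) heq
  simp only [coeff_add] at hcoeff
  have hlhs := coeff_eq_zero_of_natDegree_lt
    ((natDegree_PII_derivative_terms_le P Q).trans_lt
      (show P.natDegree + 2 * Q.natDegree < 3 * Q.natDegree by omega))
  have hcube : (2 * P ^ 3 : ℂ[X]).coeff (3 * Q.natDegree) = 0 := by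
    refine coeff_eq_zero_of_natDegree_lt ?_
    rw [natDegree_mul two_ne_zero (pow_ne_zero 3 hP0), natDegree_ofNat, natDegree_pow]
    omega
  have hlin : (X * P * Q ^ 2).coeff (3 * Q.natDegree) = P.coeff (Q.natDegree - 1) := by
    have h := coeff_mul_add_eq_of_natDegree_le (show P.natDegree ≤ Q.natDegree - 1 by omega)
      (show (Q ^ 2).natDegree ≤ 2 * Q.natDegree from natDegree_pow_le_of_le 2 le_rfl)
    rw [mul_assoc, show 3 * Q.natDegree = Q.natDegree - 1 + 2 * Q.natDegree + 1 by omega,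
      coeff_X_mul, h, coeff_pow_of_natDegree_le le_rfl, hQ.coeff_natDegree, one_pow, mul_one]
  have hconst : (C α * Q ^ 3).coeff (3 * Q.natDegree) = α := by
    rw [coeff_C_mul, coeff_pow_of_natDegree_le le_rfl, hQ.coeff_natDegree, one_pow, mul_one]
  rw [hlhs, hcube, hlin, hconst] at hcoeff
  linear_combination -hcoeff

/-- At a pole, a rational solution of the second Painlevé equation has residue `±1`. -/
theorem eval_sq_eq_of_PII_polynomial_equation {P Q : ℂ[X]} {α : ℂ} (hPQ : IsCoprime P Q)
    (heq : derivative (derivative P) * Q ^ 2 + 2 * P * derivative Q ^ 2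
        - 2 * derivative P * derivative Q * Q - P * derivative (derivative Q) * Q =
      2 * P ^ 3 + X * P * Q ^ 2 + C α * Q ^ 3) {a : ℂ} (ha : Q.eval a = 0) :
    P.eval a ≠ 0 ∧ P.eval a ^ 2 = (derivative Q).eval a ^ 2 := by
  have hPa : P.eval a ≠ 0 := by
    intro hP
    obtain ⟨u, v, huv⟩ := hPQ
    simpa [hP, ha] using congrArg (eval a) huv
  refine ⟨hPa, mul_left_cancel₀ hPa ?_⟩
  have h := congrArg (eval a) heq
  simp only [eval_add, eval_sub, eval_mul, eval_pow, eval_ofNat, eval_X, eval_C, ha] at h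
  linear_combination -h / 2


/-- If the second Painlevé equation `w″ = 2w³ + X·w + α` has a rational
solution `w ∈ ℂ(X)`, then the parameter `α` is an integer. -/
theorem PII_rational_solution_integer_parameter
    (D : RatFunc ℂ → RatFunc ℂ)
    (hD_add : ∀ x y : RatFunc ℂ, D (x + y) = D x + D y)
    (hD_mul : ∀ x y : RatFunc ℂ, D (x * y) = x * D y + D x * y)
    (hD_poly : ∀ p : Polynomial ℂ,
      D (algebraMap (Polynomial ℂ) (RatFunc ℂ) p) =
        algebraMap (Polynomial ℂ) (RatFunc ℂ) (Polynomial.derivative p))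
    (α : ℂ) (w : RatFunc ℂ)
    (hw : D (D w) = 2 * w ^ 3 + RatFunc.X * w + RatFunc.C α) :
    ∃ m : ℤ, α = (m : ℂ) := by
  have hden : algebraMap ℂ[X] (RatFunc ℂ) w.denom ≠ 0 :=
    RatFunc.algebraMap_ne_zero w.denom_ne_zero
  have hwPQ : w * algebraMap ℂ[X] (RatFunc ℂ) w.denom = algebraMap ℂ[X] (RatFunc ℂ) w.num :=
    (eq_div_iff hden).1 (RatFunc.num_div_denom w).symm
  have heq := PII_polynomial_equation D hD_add hD_mul hD_poly hw hwPQ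
  have hQ := w.monic_denom
  have hpole (a : ℂ) (ha : a ∈ w.denom.roots) :=
    eval_sq_eq_of_PII_polynomial_equation w.isCoprime_num_denom heq (isRoot_of_mem_roots ha)
  have hnodup : w.denom.roots.Nodup := by
    classical
    rw [Multiset.nodup_iff_count_le_one]
    intro a
    by_contra! hlt
    rw [count_roots, one_lt_rootMultiplicity_iff_isRoot hQ.ne_zero] at hlt
    obtain ⟨hP, hres⟩ := hpole a ((mem_roots hQ.ne_zero).2 hlt.1)
    rw [hlt.2.eq_zero, zero_pow two_ne_zero] at hres
    exact hP (eq_zero_of_pow_eq_zero hres)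
  have hdeg := degree_lt_of_PII_polynomial_equation hQ heq
  obtain ⟨m, hm⟩ := coeff_natDegree_sub_one_mem_int_of_residues hQ hnodup hdeg
    fun a ha => (hpole a ha).2
  refine ⟨-m, ?_⟩
  rw [parameter_eq_neg_coeff_of_PII_polynomial_equation hQ heq hdeg, hm, Int.cast_neg]
end

section
/- Let α ∈ ℂ and let w₁, w₂ ∈ ℂ(X) be rational functions both satisfying the second Painlevé equation w″ = 2w³ + X·w + α. Then w₁ = w₂; that is, for each value of the parameter α the second Painlevé equation has at most one rational solution. -/
open Classical in
/-- A derivation of `ℂ(X)` extending the derivative of polynomials does not increase the valuation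
at infinity. -/
lemma RatFunc.inftyValuation_derivation_le {D : RatFunc ℂ → RatFunc ℂ}
    (hD_mul : ∀ x y : RatFunc ℂ, D (x * y) = x * D y + D x * y)
    (hD_poly : ∀ p : Polynomial ℂ,
      D (algebraMap (Polynomial ℂ) (RatFunc ℂ) p) =
        algebraMap (Polynomial ℂ) (RatFunc ℂ) (Polynomial.derivative p))
    (f : RatFunc ℂ) :
    RatFunc.inftyValuation ℂ (D f) ≤ RatFunc.inftyValuation ℂ f := by
  set v := RatFunc.inftyValuation ℂ with hv
  set ι := algebraMap (Polynomial ℂ) (RatFunc ℂ)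
  have poly_le (p : Polynomial ℂ) : v (ι p.derivative) ≤ v (ι p) := by
    by_cases hp : p.derivative = 0
    · simp [hp]
    have hp0 : p ≠ 0 := by rintro rfl; simp at hp
    rw [hv, RatFunc.inftyValuation_apply, RatFunc.inftyValuation_apply,
      RatFunc.inftyValuation.polynomial ℂ hp, RatFunc.inftyValuation.polynomial ℂ hp0,
      WithZero.exp_le_exp]
    exact_mod_cast (Polynomial.natDegree_derivative_le p).trans (Nat.sub_le _ _)
  have hq : ι f.denom ≠ 0 := RatFunc.algebraMap_ne_zero f.denom_ne_zero
  have hvq : 0 < v (ι f.denom) := zero_lt_iff.mpr (v.ne_zero_iff.mpr hq)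
  have hf : f * ι f.denom = ι f.num := by
    rw [← eq_div_iff hq, RatFunc.num_div_denom]
  have key : D f * ι f.denom = ι f.num.derivative - f * ι f.denom.derivative := by
    rw [← hD_poly f.num, ← hD_poly f.denom, ← hf, hD_mul]
    ring
  refine le_of_mul_le_mul_right ?_ hvq
  rw [← map_mul, ← map_mul, key]
  refine v.map_sub_le ?_ ?_
  · rw [hf]
    exact poly_le _
  · rw [map_mul, map_mul]
    exact mul_le_mul_right (poly_le _) _

open Classical in
/-- A rational solution of the second Painlevé equation has no pole at infinity. -/
lemma RatFunc.inftyValuation_le_one_of_PII {D : RatFunc ℂ → RatFunc ℂ}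
    (hD : ∀ f, RatFunc.inftyValuation ℂ (D f) ≤ RatFunc.inftyValuation ℂ f)
    {α : ℂ} {w : RatFunc ℂ}
    (hw : D (D w) = 2 * w ^ 3 + RatFunc.X * w + RatFunc.C α) :
    RatFunc.inftyValuation ℂ w ≤ 1 := by
  set v := RatFunc.inftyValuation ℂ with hv
  by_contra! h
  have h0 : v w ≠ 0 := (zero_lt_one.trans h).ne'
  have hX : v RatFunc.X ≤ v w := by
    rw [hv, RatFunc.inftyValuation.X, ← hv, ← WithZero.exp_log h0, WithZero.exp_le_exp]
    have : 0 < WithZero.log (v w) := by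
      rwa [← WithZero.exp_lt_exp, WithZero.exp_log h0, WithZero.exp_zero]
    lia
  have hC : v (RatFunc.C α) ≤ 1 := by
    by_cases hα : α = 0
    · simp [hα]
    · rw [hv, RatFunc.inftyValuation.C ℂ hα]
  have h2 : v 2 = 1 := by
    rw [← map_ofNat (RatFunc.C (K := ℂ)) 2, hv, RatFunc.inftyValuation.C ℂ two_ne_zero]
  have hsq : v w ≤ v w ^ 2 := le_self_pow₀ h.le two_ne_zero
  have hle : v (2 * w ^ 3) ≤ v w ^ 2 := by
    rw [show 2 * w ^ 3 = D (D w) - RatFunc.X * w - RatFunc.C α by rw [hw]; ring]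
    refine v.map_sub_le (v.map_sub_le ?_ ?_) ?_
    · exact ((hD _).trans (hD _)).trans hsq
    · rw [map_mul, sq]
      exact mul_le_mul_left hX _
    · exact hC.trans (h.le.trans hsq)
  rw [map_mul, h2, one_mul, map_pow] at hle
  exact hle.not_gt (pow_lt_pow_right₀ h (by norm_num))

/-- For each parameter `α`, the second Painlevé equation has at most one
rational solution. -/
theorem PII_rational_solution_unique
    (D : RatFunc ℂ → RatFunc ℂ)
    (hD_add : ∀ x y : RatFunc ℂ, D (x + y) = D x + D y)
    (hD_mul : ∀ x y : RatFunc ℂ, D (x * y) = x * D y + D x * y)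
    (hD_poly : ∀ p : Polynomial ℂ,
      D (algebraMap (Polynomial ℂ) (RatFunc ℂ) p) =
        algebraMap (Polynomial ℂ) (RatFunc ℂ) (Polynomial.derivative p))
    (α : ℂ) (w₁ w₂ : RatFunc ℂ)
    (hw₁ : D (D w₁) = 2 * w₁ ^ 3 + RatFunc.X * w₁ + RatFunc.C α)
    (hw₂ : D (D w₂) = 2 * w₂ ^ 3 + RatFunc.X * w₂ + RatFunc.C α) :
    w₁ = w₂ := by
  classical
  have hD := RatFunc.inftyValuation_derivation_le hD_mul hD_poly
  have h₁ := RatFunc.inftyValuation_le_one_of_PII hD hw₁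
  have h₂ := RatFunc.inftyValuation_le_one_of_PII hD hw₂
  set v := RatFunc.inftyValuation ℂ with hv
  by_contra hne
  set u := w₁ - w₂ with hu
  have hu0 : v u ≠ 0 := v.ne_zero_iff.mpr (sub_ne_zero.mpr hne)
  have hDw : D (D w₁) = D (D u) + D (D w₂) := by
    rw [← hD_add, ← hD_add, hu, sub_add_cancel]
  have key : RatFunc.X * u = D (D u) - 2 * (w₁ ^ 2 + w₁ * w₂ + w₂ ^ 2) * u := by
    rw [hw₁, hw₂] at hDw
    linear_combination hDw + (RatFunc.X + 2 * (w₁ ^ 2 + w₁ * w₂ + w₂ ^ 2)) * hu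
  have h2 : v 2 ≤ 1 := by
    rw [← map_ofNat (RatFunc.C (K := ℂ)) 2, hv, RatFunc.inftyValuation.C ℂ two_ne_zero]
  have hcoeff : v (2 * (w₁ ^ 2 + w₁ * w₂ + w₂ ^ 2)) ≤ 1 := by
    rw [map_mul]
    refine mul_le_one' h2 (v.map_add_le (v.map_add_le ?_ ?_) ?_)
    · rw [map_pow]; exact pow_le_one' h₁ 2
    · rw [map_mul]; exact mul_le_one' h₁ h₂
    · rw [map_pow]; exact pow_le_one' h₂ 2
  have hle : v (RatFunc.X * u) ≤ v u := by
    rw [key]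
    refine v.map_sub_le ((hD _).trans (hD _)) ?_
    rw [map_mul]
    exact mul_le_of_le_one_left' hcoeff
  have hX : 1 < v RatFunc.X := by
    rw [hv, RatFunc.inftyValuation.X, ← WithZero.exp_zero, WithZero.exp_lt_exp]
    exact zero_lt_one
  rw [map_mul] at hle
  exact hle.not_gt (lt_mul_of_one_lt_left (zero_lt_iff.mpr hu0) hX)
end
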